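/- Let q, z be complex numbers with q ≠ 0, z ≠ 0, and let n ≥ 0 and l be integers with 0 ≤ l ≤ n. Assume q^j ≠ 1 for all 1 ≤ j ≤ n, and z·q^{k-1} ≠ 1 for all 1 ≤ k ≤ n. Then ∑_{k=1}^{n} [n choose k]_q · (q/z;q)_k · (z·q^{-l};q)_{n-k} · z^k / (1 - q^k) = (z·q^{-l};q)_n · ( ∑_{k=1}^{n-l} z·q^{k-1}/(1 - z·q^{k-1}) − ∑_{k=1}^{n} q^k/(1 - q^k) ). -/

import Mathlib

open Finset

/-- The q-Pochhammer symbol `(x;q)_N = ∏_{j=0}^{N-1} (1 - x q^j)`. -/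
noncomputable def qPoch (q x : ℂ) (N : ℕ) : ℂ := ∏ j ∈ Finset.range N, (1 - x * q ^ j)

/-- The Gaussian binomial coefficient `[n choose k]_q = (q;q)_n / ((q;q)_k (q;q)_{n-k})`. -/
noncomputable def qBinom (q : ℂ) (n k : ℕ) : ℂ := qPoch q q n / (qPoch q q k * qPoch q q (n - k))

open Filter Topology in
theorem eventually_nhdsNE_mul_ne_one (a w : ℂ) :
    ∀ᶠ v in 𝓝[≠] w, v * a ≠ 1 := by
  have hfin : ({a⁻¹} \ {w} : Set ℂ).Finite := (Set.finite_singleton _).subset Set.sdiff_subset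
  have hw : w ∉ ({a⁻¹} \ {w} : Set ℂ) := by simp
  filter_upwards [nhdsWithin_le_nhds (hfin.isClosed.isOpen_compl.mem_nhds hw),
    self_mem_nhdsWithin] with v hv hvw h
  exact hv ⟨eq_inv_of_mul_eq_one_left h, hvw⟩

/-- The Gaussian binomial coefficient, defined by the `q`-Pascal recursion, so that it makes sense
for every `q` and vanishes for `k > n`. -/
noncomputable def gaussBinom (q : ℂ) : ℕ → ℕ → ℂ
  | _, 0 => 1
  | 0, _ + 1 => 0
  | n + 1, k + 1 => gaussBinom q n k + q ^ (k + 1) * gaussBinom q n (k + 1)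

theorem gaussBinom_zero_right (q : ℂ) (n : ℕ) : gaussBinom q n 0 = 1 := by
  cases n <;> rfl

theorem gaussBinom_succ_succ (q : ℂ) (n k : ℕ) :
    gaussBinom q (n + 1) (k + 1) = gaussBinom q n k + q ^ (k + 1) * gaussBinom q n (k + 1) := rfl

theorem gaussBinom_eq_zero_of_lt (q : ℂ) {n k : ℕ} (h : n < k) : gaussBinom q n k = 0 := by
  induction n generalizing k with
  | zero => obtain ⟨k, rfl⟩ := Nat.exists_eq_succ_of_ne_zero h.ne'; rfl
  | succ n ih =>
    obtain ⟨k, rfl⟩ := Nat.exists_eq_succ_of_ne_zero (Nat.ne_zero_of_lt h)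
    rw [Nat.succ_eq_add_one, gaussBinom_succ_succ, ih (by omega), ih (by omega)]
    ring

theorem one_sub_pow_mul_gaussBinom_succ_right (q : ℂ) {n k : ℕ} (h : k ≤ n) :
    (1 - q ^ (k + 1)) * gaussBinom q n (k + 1) = (1 - q ^ (n - k)) * gaussBinom q n k := by
  induction n generalizing k with
  | zero =>
    obtain rfl : k = 0 := by omega
    simp [gaussBinom]
  | succ n ih =>
    cases k with
    | zero =>
      have h0 := ih (Nat.zero_le n)
      simp only [gaussBinom_succ_succ, gaussBinom_zero_right, Nat.sub_zero, zero_add] at h0 ⊢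
      linear_combination q * h0
    | succ k =>
      rcases Nat.lt_or_ge n (k + 1) with hk | hk
      · rw [gaussBinom_eq_zero_of_lt q (by omega : n + 1 < k + 1 + 1),
          show n + 1 - (k + 1) = 0 by omega]
        simp
      · obtain ⟨m, rfl⟩ := Nat.exists_eq_add_of_le hk
        have h1 := ih hk
        have h2 := ih (by omega : k ≤ k + 1 + m)
        rw [show k + 1 + m - (k + 1) = m by omega] at h1
        rw [show k + 1 + m - k = m + 1 by omega] at h2
        rw [show k + 1 + m + 1 - (k + 1) = m + 1 by omega, gaussBinom_succ_succ,
          gaussBinom_succ_succ]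
        linear_combination q ^ (k + 1 + 1) * h1 + h2

theorem one_sub_pow_mul_gaussBinom_succ_succ (q : ℂ) {n k : ℕ} (h : k ≤ n) :
    (1 - q ^ (k + 1)) * gaussBinom q (n + 1) (k + 1) = (1 - q ^ (n + 1)) * gaussBinom q n k := by
  have h1 := one_sub_pow_mul_gaussBinom_succ_right q h
  obtain ⟨m, rfl⟩ := Nat.exists_eq_add_of_le h
  rw [show k + m - k = m by omega] at h1
  rw [gaussBinom_succ_succ]
  linear_combination q ^ (k + 1) * h1

theorem gaussBinom_succ_succ' (q : ℂ) {n k : ℕ} (h : k ≤ n) :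
    gaussBinom q (n + 1) (k + 1) = gaussBinom q n (k + 1) + q ^ (n - k) * gaussBinom q n k := by
  rw [gaussBinom_succ_succ]
  linear_combination -one_sub_pow_mul_gaussBinom_succ_right q h

theorem qPoch_succ (q x : ℂ) (n : ℕ) : qPoch q x (n + 1) = qPoch q x n * (1 - x * q ^ n) :=
  Finset.prod_range_succ _ _

theorem qPoch_self_ne_zero {q : ℂ} {n : ℕ} (h : ∀ j : ℕ, 1 ≤ j → j ≤ n → q ^ j ≠ 1) :
    qPoch q q n ≠ 0 := by
  refine Finset.prod_ne_zero_iff.mpr fun j hj => ?_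
  rw [← pow_succ']
  exact sub_ne_zero.mpr (h (j + 1) (by omega) (by have := Finset.mem_range.mp hj; omega)).symm

theorem gaussBinom_mul_qPoch (q : ℂ) {n k : ℕ} (h : k ≤ n) :
    gaussBinom q n k * (qPoch q q k * qPoch q q (n - k)) = qPoch q q n := by
  induction n generalizing k with
  | zero =>
    obtain rfl : k = 0 := by omega
    simp [gaussBinom, qPoch]
  | succ n ih =>
    cases k with
    | zero => simp [gaussBinom, qPoch]
    | succ k =>
      have h1 := ih (by omega : k ≤ n)
      have h2 := one_sub_pow_mul_gaussBinom_succ_succ q (by omega : k ≤ n)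
      rw [Nat.add_sub_add_right, qPoch_succ, qPoch_succ]
      linear_combination qPoch q q k * qPoch q q (n - k) * h2 + (1 - q ^ (n + 1)) * h1

theorem qBinom_eq_gaussBinom {q : ℂ} {n k : ℕ} (h : ∀ j : ℕ, 1 ≤ j → j ≤ n → q ^ j ≠ 1)
    (hk : k ≤ n) : qBinom q n k = gaussBinom q n k := by
  have h1 : qPoch q q k ≠ 0 := qPoch_self_ne_zero fun j hj hjk => h j hj (hjk.trans hk)
  have h2 : qPoch q q (n - k) ≠ 0 :=
    qPoch_self_ne_zero fun j hj hjk => h j hj (hjk.trans (Nat.sub_le n k))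
  rw [qBinom, div_eq_iff (mul_ne_zero h1 h2), gaussBinom_mul_qPoch q hk]

/-- The homogeneous `q`-shifted factorial `∏_{j=0}^{n-1} (z - x q^j)`. -/
noncomputable def qShift (q z x : ℂ) (n : ℕ) : ℂ := ∏ j ∈ Finset.range n, (z - x * q ^ j)

theorem qShift_succ (q z x : ℂ) (n : ℕ) : qShift q z x (n + 1) = qShift q z x n * (z - x * q ^ n) :=
  Finset.prod_range_succ _ _

theorem qShift_zero (q z x : ℂ) : qShift q z x 0 = 1 := Finset.prod_range_zero _

theorem qShift_succ' (q z x : ℂ) (n : ℕ) :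
    qShift q z x (n + 1) = qShift q z (x * q) n * (z - x) := by
  simp [qShift, Finset.prod_range_succ', pow_succ', mul_assoc]

theorem qShift_one_left (q x : ℂ) (n : ℕ) : qShift q 1 x n = qPoch q x n := rfl

theorem qShift_mul_mul (q c z x : ℂ) (n : ℕ) :
    qShift q (c * z) (c * x) n = c ^ n * qShift q z x n := by
  simp only [qShift, mul_assoc, ← mul_sub, Finset.prod_mul_distrib, Finset.prod_const,
    Finset.card_range]

theorem qPoch_div_mul_pow {z : ℂ} (q x : ℂ) (hz : z ≠ 0) (n : ℕ) :
    qPoch q (x / z) n * z ^ n = qShift q z x n := by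
  rw [← qShift_one_left, mul_comm, ← qShift_mul_mul, mul_one, mul_div_cancel₀ _ hz]

/-- The homogeneous `q`-Chu–Vandermonde identity. -/
theorem sum_gaussBinom_mul_qShift (q w x z : ℂ) (n : ℕ) :
    ∑ k ∈ Finset.range (n + 1), gaussBinom q n k * qShift q x w (n - k) * qShift q z x k
      = qShift q z w n := by
  induction n with
  | zero => simp [gaussBinom, qShift]
  | succ n ih =>
    have hsplit : qShift q z w (n + 1)
        = ∑ k ∈ Finset.range (n + 1),
            gaussBinom q n k * qShift q x w (n - k) * qShift q z x (k + 1)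
          + ∑ k ∈ Finset.range (n + 1),
            q ^ k * gaussBinom q n k * qShift q x w (n + 1 - k) * qShift q z x k := by
      rw [qShift_succ, ← ih, Finset.sum_mul, ← Finset.sum_add_distrib]
      refine Finset.sum_congr rfl fun k hk => ?_
      obtain ⟨m, rfl⟩ := Nat.exists_eq_add_of_le (Nat.lt_succ_iff.mp (Finset.mem_range.mp hk))
      rw [show k + m + 1 - k = m + 1 by omega, show k + m - k = m by omega, qShift_succ,
        qShift_succ]
      ring
    have hext : ∑ k ∈ Finset.range (n + 1),
            q ^ k * gaussBinom q n k * qShift q x w (n + 1 - k) * qShift q z x k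
        = ∑ k ∈ Finset.range (n + 1), q ^ (k + 1) * gaussBinom q n (k + 1)
            * qShift q x w (n - k) * qShift q z x (k + 1) + qShift q x w (n + 1) := by
      have h := Finset.sum_range_succ (fun k => q ^ k * gaussBinom q n k
        * qShift q x w (n + 1 - k) * qShift q z x k) (n + 1)
      rw [Finset.sum_range_succ', gaussBinom_eq_zero_of_lt q (Nat.lt_succ_self n)] at h
      simp only [Nat.add_sub_add_right, gaussBinom_zero_right, qShift_zero] at h
      rw [Nat.sub_zero] at h
      linear_combination -h
    rw [hsplit, hext, Finset.sum_range_succ', ← add_assoc, ← Finset.sum_add_distrib]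
    simp only [Nat.add_sub_add_right, gaussBinom_zero_right, qShift_zero, Nat.sub_zero, one_mul,
      mul_one]
    congr 1
    refine Finset.sum_congr rfl fun k _ => ?_
    rw [gaussBinom_succ_succ]
    ring

theorem sum_gaussBinom_mul_qPoch_mul_qShift_one (q w z : ℂ) (n : ℕ) :
    ∑ k ∈ Finset.range n, gaussBinom q n (k + 1) * qPoch q w (n - (k + 1)) * qShift q z 1 (k + 1)
      = qShift q z w n - qPoch q w n := by
  have h := sum_gaussBinom_mul_qShift q w 1 z n
  rw [Finset.sum_range_succ', gaussBinom_zero_right, qShift_zero, Nat.sub_zero] at h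
  simp only [qShift_one_left] at h
  linear_combination h

theorem sum_gaussBinom_mul_pow_mul_qPoch_mul_qShift (q w z : ℂ) (n : ℕ) :
    ∑ k ∈ Finset.range n, gaussBinom q n (k + 1)
        * (q ^ (n - (k + 1)) * qPoch q w (n - (k + 1))) * qShift q z q (k + 1)
      = qShift q z (q * w) n - q ^ n * qPoch q w n := by
  have hP : ∀ m, qShift q q (q * w) m = q ^ m * qPoch q w m := fun m => by
    rw [← qShift_one_left, ← qShift_mul_mul, mul_one]
  have h := sum_gaussBinom_mul_qShift q (q * w) q z n
  rw [Finset.sum_range_succ', gaussBinom_zero_right, qShift_zero, Nat.sub_zero] at h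
  simp only [hP] at h
  linear_combination h

/-- The sum `∑_{k=1}^n [n choose k]_q (w;q)_{n-k} ∏_{j=1}^k (z - q^j) / (1 - q^k)`. -/
noncomputable def weightedSum (q w z : ℂ) (n : ℕ) : ℂ :=
  ∑ k ∈ Finset.range n,
    gaussBinom q n (k + 1) * qPoch q w (n - (k + 1)) * qShift q z q (k + 1) / (1 - q ^ (k + 1))

theorem weightedSum_succ {q : ℂ} (w z : ℂ) {n : ℕ}
    (hq : ∀ j : ℕ, 1 ≤ j → j ≤ n + 1 → q ^ j ≠ 1) :
    weightedSum q w z (n + 1) = (1 - w * q ^ n) * weightedSum q w z n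
      + w * q ^ n * qPoch q w n - q ^ (n + 1) / (1 - q ^ (n + 1)) * qPoch q w (n + 1)
      + (z - w) / (1 - q ^ (n + 1)) * qShift q z (q * w) n := by
  have hne : ∀ k, k ≤ n → (1 : ℂ) - q ^ (k + 1) ≠ 0 := fun k hk =>
    sub_ne_zero.mpr (hq (k + 1) (by omega) (by omega)).symm
  have hsplit : weightedSum q w z (n + 1)
      = ∑ k ∈ Finset.range (n + 1), gaussBinom q n (k + 1) * qPoch q w (n - k)
          * qShift q z q (k + 1) / (1 - q ^ (k + 1))
        + (∑ k ∈ Finset.range (n + 1), gaussBinom q (n + 1) (k + 1)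
            * (q ^ (n + 1 - (k + 1)) * qPoch q w (n + 1 - (k + 1))) * qShift q z q (k + 1))
          / (1 - q ^ (n + 1)) := by
    rw [weightedSum, Finset.sum_div, ← Finset.sum_add_distrib]
    refine Finset.sum_congr rfl fun k hk => ?_
    have hk' : k ≤ n := Nat.lt_succ_iff.mp (Finset.mem_range.mp hk)
    have h1 := one_sub_pow_mul_gaussBinom_succ_succ q hk'
    have h2 := gaussBinom_succ_succ' q hk'
    have hk0 := hne k hk'
    have hn0 := hne n le_rfl
    rw [Nat.add_sub_add_right, div_add_div _ _ hk0 hn0, div_eq_div_iff hk0 (mul_ne_zero hk0 hn0)]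
    linear_combination (1 - q ^ (k + 1)) * qPoch q w (n - k) * qShift q z q (k + 1)
      * ((1 - q ^ (n + 1)) * h2 - q ^ (n - k) * h1)
  have hfirst : ∑ k ∈ Finset.range (n + 1), gaussBinom q n (k + 1) * qPoch q w (n - k)
          * qShift q z q (k + 1) / (1 - q ^ (k + 1))
      = (1 - w * q ^ n) * weightedSum q w z n
        - w * ∑ k ∈ Finset.range n, gaussBinom q n (k + 1)
            * (q ^ (n - (k + 1)) * qPoch q w (n - (k + 1))) * qShift q z q (k + 1) := by
    rw [Finset.sum_range_succ, gaussBinom_eq_zero_of_lt q (Nat.lt_succ_self n), weightedSum,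
      Finset.mul_sum, Finset.mul_sum, ← Finset.sum_sub_distrib]
    simp only [zero_mul, zero_div, add_zero]
    refine Finset.sum_congr rfl fun k hk => ?_
    obtain ⟨m, rfl⟩ := Nat.exists_eq_add_of_lt (Finset.mem_range.mp hk)
    have hk0 := hne k (by omega)
    rw [show k + m + 1 - k = m + 1 by omega, show k + m + 1 - (k + 1) = m by omega, qPoch_succ]
    field_simp
    ring
  have hn0 := hne n le_rfl
  rw [hsplit, hfirst, sum_gaussBinom_mul_pow_mul_qPoch_mul_qShift,
    sum_gaussBinom_mul_pow_mul_qPoch_mul_qShift, qShift_succ]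
  field_simp
  ring

theorem weightedSum_self {q w : ℂ} {n : ℕ} (hq : ∀ j : ℕ, 1 ≤ j → j ≤ n → q ^ j ≠ 1)
    (hw : ∀ j < n, w * q ^ j ≠ 1) :
    weightedSum q w w n = qPoch q w n
      * (∑ j ∈ Finset.range n, w * q ^ j / (1 - w * q ^ j)
        - ∑ j ∈ Finset.range n, q ^ (j + 1) / (1 - q ^ (j + 1))) := by
  induction n with
  | zero => simp [weightedSum]
  | succ n ih =>
    have hn : (1 : ℂ) - w * q ^ n ≠ 0 := sub_ne_zero.mpr (hw n (Nat.lt_succ_self n)).symm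
    rw [weightedSum_succ w w hq, ih (fun j h1 h2 => hq j h1 (by omega)) fun j hj => hw j (by omega),
      Finset.sum_range_succ, Finset.sum_range_succ, qPoch_succ, sub_self, zero_div, zero_mul]
    have hc : (1 - w * q ^ n) * (w * q ^ n / (1 - w * q ^ n)) = w * q ^ n :=
      mul_div_cancel₀ _ hn
    linear_combination -qPoch q w n * hc

theorem one_sub_mul_weightedSum_sub {q : ℂ} (w z : ℂ) {n : ℕ}
    (hq : ∀ j : ℕ, 1 ≤ j → j ≤ n → q ^ j ≠ 1) :
    (1 - z) * (weightedSum q w z n - weightedSum q w (q * z) n)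
      = z * (qPoch q w n - qShift q z w n) := by
  have h := sum_gaussBinom_mul_qPoch_mul_qShift_one q w z n
  rw [← neg_sub (qShift q z w n), ← h, weightedSum, weightedSum, ← Finset.sum_sub_distrib,
    Finset.mul_sum, ← Finset.sum_neg_distrib, Finset.mul_sum]
  refine Finset.sum_congr rfl fun k hk => ?_
  have hk0 : (1 : ℂ) - q ^ (k + 1) ≠ 0 :=
    sub_ne_zero.mpr (hq (k + 1) (by omega) (Finset.mem_range.mp hk)).symm
  have h1 : qShift q (q * z) q (k + 1) = q ^ (k + 1) * qShift q z 1 (k + 1) := by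
    rw [← qShift_mul_mul, mul_one]
  rw [h1, qShift_succ' q z 1, one_mul, qShift_succ]
  field_simp
  ring

theorem weightedSum_mul_pow_of_forall_ne {q w : ℂ} {n l : ℕ} (hl : l ≤ n)
    (hq : ∀ j : ℕ, 1 ≤ j → j ≤ n → q ^ j ≠ 1) (hw : ∀ j < n, w * q ^ j ≠ 1) :
    weightedSum q w (w * q ^ l) n = qPoch q w n
      * (∑ j ∈ Finset.Ico l n, w * q ^ j / (1 - w * q ^ j)
        - ∑ j ∈ Finset.range n, q ^ (j + 1) / (1 - q ^ (j + 1))) := by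
  induction l with
  | zero => rw [pow_zero, mul_one, weightedSum_self hq hw, Nat.Ico_zero_eq_range]
  | succ l ih =>
    have hl0 : (1 : ℂ) - w * q ^ l ≠ 0 := sub_ne_zero.mpr (hw l hl).symm
    have hdiff := one_sub_mul_weightedSum_sub w (w * q ^ l) hq
    have hzero : qShift q (w * q ^ l) w n = 0 :=
      Finset.prod_eq_zero (Finset.mem_range.mpr hl) (sub_self _)
    have hc : (1 - w * q ^ l) * (w * q ^ l / (1 - w * q ^ l)) = w * q ^ l :=
      mul_div_cancel₀ _ hl0
    rw [hzero, ih (by omega), Finset.sum_eq_sum_Ico_succ_bot hl,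
      show q * (w * q ^ l) = w * q ^ (l + 1) by ring] at hdiff
    refine mul_left_cancel₀ hl0 ?_
    linear_combination -hdiff + qPoch q w n * hc

open Filter Topology in
theorem weightedSum_mul_pow {q w : ℂ} {n l : ℕ} (hl : l ≤ n)
    (hq : ∀ j : ℕ, 1 ≤ j → j ≤ n → q ^ j ≠ 1) (hw : ∀ j ∈ Finset.Ico l n, w * q ^ j ≠ 1) :
    weightedSum q w (w * q ^ l) n = qPoch q w n
      * (∑ j ∈ Finset.Ico l n, w * q ^ j / (1 - w * q ^ j)
        - ∑ j ∈ Finset.range n, q ^ (j + 1) / (1 - q ^ (j + 1))) := by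
  have hleft : ContinuousAt (fun v => weightedSum q v (v * q ^ l) n) w := by
    unfold weightedSum qPoch qShift
    fun_prop
  have hpoch : ContinuousAt (fun v => qPoch q v n) w := by
    unfold qPoch
    fun_prop
  have hsum : ContinuousAt (fun v => ∑ j ∈ Finset.Ico l n, v * q ^ j / (1 - v * q ^ j)) w :=
    tendsto_finsetSum _ fun j hj =>
      ContinuousAt.div (by fun_prop) (by fun_prop) (sub_ne_zero.mpr (hw j hj).symm)
  have hgen : ∀ᶠ v in 𝓝[≠] w, ∀ j ∈ Finset.range n, v * q ^ j ≠ 1 :=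
    (Filter.eventually_all_finset _).mpr fun j _ =>
      eventually_nhdsNE_mul_ne_one (q ^ j) w
  refine Filter.EventuallyEq.eq_of_nhds
    ((ContinuousAt.eventuallyEq_nhds_iff_eventuallyEq_nhdsNE hleft
      (hpoch.mul (hsum.sub continuousAt_const))).mp ?_)
  filter_upwards [hgen] with v hv
  exact weightedSum_mul_pow_of_forall_ne hl hq fun j hj => hv j (Finset.mem_range.mpr hj)

theorem stmt_8 (q z : ℂ) (hq : q ≠ 0) (hz : z ≠ 0) (n l : ℕ) (hl : l ≤ n)
    (hq1 : ∀ j : ℕ, 1 ≤ j → j ≤ n → q ^ j ≠ 1)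
    (hz1 : ∀ k : ℕ, 1 ≤ k → k ≤ n → z * q ^ (k - 1) ≠ 1) :
    ∑ k ∈ Finset.Icc 1 n,
        qBinom q n k * qPoch q (q / z) k * qPoch q (z * q ^ (-(l : ℤ))) (n - k) * z ^ k
          / (1 - q ^ k)
      = qPoch q (z * q ^ (-(l : ℤ))) n
          * ((∑ k ∈ Finset.Icc 1 (n - l), z * q ^ (k - 1) / (1 - z * q ^ (k - 1)))
             - ∑ k ∈ Finset.Icc 1 n, q ^ k / (1 - q ^ k)) := by
  have hIcc : ∀ (f : ℕ → ℂ) (m : ℕ),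
      ∑ k ∈ Finset.Icc 1 m, f k = ∑ k ∈ Finset.range m, f (k + 1) := fun f m => by
    rw [← Finset.Ico_add_one_right_eq_Icc, Finset.sum_Ico_eq_sum_range]
    simp only [Nat.add_sub_cancel, add_comm 1]
  set w : ℂ := z * q ^ (-(l : ℤ)) with hw
  have hwz : ∀ j, w * q ^ (l + j) = z * q ^ j := fun j => by
    rw [hw, zpow_neg, zpow_natCast, pow_add]
    field_simp
  have hmain := weightedSum_mul_pow (w := w) hl hq1 fun j hj => by
    obtain ⟨m, rfl⟩ := Nat.exists_eq_add_of_le (Finset.mem_Ico.mp hj).1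
    rw [hwz]
    exact hz1 (m + 1) (by omega) (by have := (Finset.mem_Ico.mp hj).2; omega)
  rw [Finset.sum_Ico_eq_sum_range, ← add_zero l, hwz, pow_zero, mul_one, add_zero] at hmain
  simp only [hwz] at hmain
  rw [hIcc, hIcc, hIcc]
  simp only [Nat.add_sub_cancel]
  rw [← hmain, weightedSum]
  refine Finset.sum_congr rfl fun k hk => ?_
  rw [qBinom_eq_gaussBinom hq1 (Finset.mem_range.mp hk), ← qPoch_div_mul_pow q q hz]
  ring
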